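/- For every proper sub-valuation u on a commutative ring A and every a ∈ A there exists a valuation w on A (proper and multiplicative: w(ab) = w(a)+w(b)) with w ≥ u and w(a) = u(a). Consequently, u = inf { w : w is a valuation on A with w ≥ u }. -/

import Mathlib

/-- A (real-valued, proper, multiplicative) valuation on a commutative ring,
with values in `ℝ ∪ {∞}` (no value `⊥`). -/
def IsRingValuation {A : Type*} [CommRing A] (w : A → EReal) : Prop :=
  (∀ x, w x ≠ ⊥) ∧ w 0 = ⊤ ∧ w 1 = 0 ∧
    (∀ x y, w (x * y) = w x + w y) ∧ (∀ x y, min (w x) (w y) ≤ w (x + y))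

/-- Multiplicative (real-valued norm) version of a proper sub-valuation. -/
structure SubNorm {A : Type*} [CommRing A] (f : A → ℝ) : Prop where
  nonneg : ∀ x, 0 ≤ f x
  zero : f 0 = 0
  one : f 1 = 1
  mul_le : ∀ x y, f (x * y) ≤ f x * f y
  sq : ∀ x, f (x ^ 2) = f x ^ 2
  add_le : ∀ x y, f (x + y) ≤ max (f x) (f y)

namespace SubNorm

variable {A : Type*} [CommRing A] {f : A → ℝ}

theorem neg_one (h : SubNorm f) : f (-1) = 1 := by
  have h1 := h.sq (-1)
  rw [neg_one_sq, h.one] at h1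
  have h2 := h.nonneg (-1)
  nlinarith

theorem neg_le (h : SubNorm f) (x : A) : f (-x) ≤ f x := by
  have := h.mul_le (-1) x
  rwa [h.neg_one, one_mul, neg_one_mul] at this

theorem neg_eq (h : SubNorm f) (x : A) : f (-x) = f x :=
  le_antisymm (h.neg_le x) (by simpa using h.neg_le (-x))

theorem pow_le (h : SubNorm f) (x : A) (n : ℕ) : f (x ^ n) ≤ f x ^ n := by
  induction n with
  | zero => simp [h.one]
  | succ n ih =>
    rw [pow_succ, pow_succ]
    exact (h.mul_le _ _).trans (mul_le_mul_of_nonneg_right ih (h.nonneg x))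

theorem two_pow (h : SubNorm f) (x : A) (k : ℕ) : f (x ^ (2 ^ k)) = f x ^ (2 ^ k) := by
  induction k with
  | zero => simp
  | succ k ih => rw [pow_succ, pow_mul, h.sq, ih, pow_mul]

theorem isPowMul (h : SubNorm f) : IsPowMul f := by
  intro x n hn
  apply le_antisymm (h.pow_le x n)
  rcases (h.nonneg x).eq_or_lt with h0 | h0
  · rw [← h0, zero_pow (by omega)]; exact h.nonneg _
  · have hk : n ≤ 2 ^ n := Nat.lt_two_pow_self.le
    obtain ⟨m, hm⟩ := Nat.exists_eq_add_of_le hk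
    have h1 := h.two_pow x n
    rw [hm, pow_add, pow_add] at h1
    have h2 := h.mul_le (x ^ n) (x ^ m)
    have h3 : f (x ^ n) * f (x ^ m) ≤ f (x ^ n) * f x ^ m :=
      mul_le_mul_of_nonneg_left (h.pow_le x m) (h.nonneg _)
    have h4 : f x ^ n * f x ^ m ≤ f (x ^ n) * f x ^ m := by linarith
    exact le_of_mul_le_mul_right h4 (pow_pos h0 m)

/-- The associated ring seminorm. -/
def toSeminorm (h : SubNorm f) : RingSeminorm A where
  toFun := f
  map_zero' := h.zero
  add_le' x y := (h.add_le x y).trans (max_le_add_of_nonneg (h.nonneg x) (h.nonneg y))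
  neg' := h.neg_eq
  mul_le' := h.mul_le

/-- The localisation of the norm at an element. -/
theorem exists_const (h : SubNorm f) (c : A) (hc : f c ≠ 0) :
    ∃ g : A → ℝ, SubNorm g ∧ (∀ x, g x ≤ f x) ∧ g c = f c ∧ (∀ x, g (c * x) = g c * g x) ∧
      ∀ a, (∀ x, f (a * x) = f a * f x) → g a = f a ∧ ∀ x, g (a * x) = g a * g x := by
  have hf1 : h.toSeminorm 1 ≤ 1 := h.one.le
  have hc' : h.toSeminorm c ≠ 0 := hc
  have hpm : IsPowMul h.toSeminorm := h.isPowMul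
  let G := seminormFromConst hf1 hc' hpm
  refine ⟨G, ⟨apply_nonneg G, map_zero G, seminormFromConst_one hf1 hc' hpm, map_mul_le_mul G,
    fun x => seminormFromConst_isPowMul hf1 hc' hpm x (by norm_num),
    seminormFromConst_isNonarchimedean hf1 hc' hpm h.add_le⟩,
    seminormFromConst_le_seminorm hf1 hc' hpm, seminormFromConst_apply_c hf1 hc' hpm,
    seminormFromConst_const_mul hf1 hc' hpm, fun a ha =>
    ⟨seminormFromConst_apply_of_isMul hf1 hc' hpm ha,
      seminormFromConst_isMul_of_isMul hf1 hc' hpm ha⟩⟩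

open Filter Topology in
theorem exists_mul (h : SubNorm f) (a : A) (ha : ∀ x, f (a * x) = f a * f x) :
    ∃ g : A → ℝ, SubNorm g ∧ (∀ x, g x ≤ f x) ∧ g a = f a ∧ ∀ x y, g (x * y) = g x * g y := by
  let S : Set (A → ℝ)ᵒᵈ :=
    {g | SubNorm (OrderDual.ofDual g) ∧ OrderDual.ofDual g a = f a ∧
      ∀ x, OrderDual.ofDual g (a * x) = f a * OrderDual.ofDual g x}
  have key := zorn_le_nonempty₀ S ?_ (OrderDual.toDual f) ⟨h, rfl, ha⟩
  · obtain ⟨m, hm1, hm2⟩ := key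
    obtain ⟨g, rfl⟩ := OrderDual.toDual.surjective m
    obtain ⟨hg, hga, hgm⟩ := hm2.prop
    simp only [OrderDual.ofDual_toDual] at hg hga hgm
    refine ⟨g, hg, hm1, hga, fun x y => ?_⟩
    by_cases hx : g x = 0
    · apply le_antisymm (hg.mul_le x y)
      rw [hx, zero_mul]; exact hg.nonneg _
    · obtain ⟨k, hk, hkle, -, hkm, hka⟩ := hg.exists_const x hx
      obtain ⟨h1, h2⟩ := hka a (by rw [hga]; exact hgm)
      have hkS : OrderDual.toDual k ∈ S :=
        ⟨hk, h1.trans hga, fun x => by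
          have := h2 x
          rw [h1, hga] at this
          exact this⟩
      have h3 : OrderDual.toDual k ≤ OrderDual.toDual g :=
        hm2.le_of_ge hkS (show k ≤ g from hkle)
      have h4 : k = g := le_antisymm hkle h3
      rw [h4] at hkm
      exact hkm y
  · intro c hcS hc y hy
    let C : Set (A → ℝ) := {g | OrderDual.toDual g ∈ c}
    have hne : Nonempty C := ⟨⟨OrderDual.ofDual y, hy⟩⟩
    have hdir : IsDirected C (· ≥ ·) := ⟨by
      rintro ⟨p, hp⟩ ⟨q, hq⟩
      rcases hc.total hp hq with h | h
      · exact ⟨⟨q, hq⟩, h, le_refl q⟩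
      · exact ⟨⟨p, hp⟩, le_refl p, h⟩⟩
    have hdir' : IsCodirectedOrder C := hdir
    have hCS : ∀ g : C, SubNorm g.1 ∧ g.1 a = f a ∧ ∀ x, g.1 (a * x) = f a * g.1 x :=
      fun g => hcS g.2
    have hbdd : ∀ x, BddBelow (Set.range fun g : C => g.1 x) := fun x =>
      ⟨0, by rintro _ ⟨g, rfl⟩; exact (hCS g).1.nonneg x⟩
    let k : A → ℝ := fun x => ⨅ g : C, g.1 x
    have hlim : ∀ x, Tendsto (fun g : C => g.1 x) atBot (𝓝 (k x)) := fun x =>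
      tendsto_atBot_ciInf (fun p q hpq => hpq x) (hbdd x)
    have hcl : ∀ {x : A} {r : ℝ}, (∀ g : C, g.1 x = r) → k x = r := fun {x r} hr => by
      refine tendsto_nhds_unique (hlim x) ?_
      simp only [hr]; exact tendsto_const_nhds
    refine ⟨OrderDual.toDual k, ⟨⟨?_, ?_, ?_, ?_, ?_, ?_⟩, ?_, ?_⟩, ?_⟩
    · exact fun x => ge_of_tendsto' (hlim x) fun g => (hCS g).1.nonneg x
    · exact hcl fun g => (hCS g).1.zero
    · exact hcl fun g => (hCS g).1.one
    · exact fun x y => le_of_tendsto_of_tendsto' (hlim _) ((hlim x).mul (hlim y))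
        fun g => (hCS g).1.mul_le x y
    · exact fun x => tendsto_nhds_unique (hlim _)
        (((hlim x).pow 2).congr fun g => ((hCS g).1.sq x).symm)
    · exact fun x y => le_of_tendsto_of_tendsto' (hlim _) ((hlim x).max (hlim y))
        fun g => (hCS g).1.add_le x y
    · exact hcl fun g => (hCS g).2.1
    · exact fun x => tendsto_nhds_unique (hlim _)
        (((hlim x).const_mul (f a)).congr fun g => ((hCS g).2.2 x).symm)
    · intro z hz x
      exact ciInf_le (hbdd x) (⟨OrderDual.ofDual z, hz⟩ : C)

theorem exists_dominated (h : SubNorm f) (a : A) :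
    ∃ g : A → ℝ, SubNorm g ∧ (∀ x, g x ≤ f x) ∧ g a = f a ∧ ∀ x y, g (x * y) = g x * g y := by
  by_cases hc : f a = 0
  · refine h.exists_mul a fun x => le_antisymm (h.mul_le a x) ?_
    rw [hc, zero_mul]; exact h.nonneg _
  · obtain ⟨k, hk, hkle, hka, hkm, -⟩ := h.exists_const a hc
    obtain ⟨g, hg, hgle, hga, hgm⟩ := hk.exists_mul a hkm
    exact ⟨g, hg, fun x => (hgle x).trans (hkle x), hga.trans hka, hgm⟩

end SubNorm

theorem exists_ringValuation {A : Type*} [CommRing A]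
    (u : A → EReal) (hbot : ∀ x, u x ≠ ⊥)
    (hmul : ∀ x y, u x + u y ≤ u (x * y))
    (hsq : ∀ x, u (x ^ 2) = 2 • u x)
    (hadd : ∀ x y, min (u x) (u y) ≤ u (x + y))
    (h0 : u 0 = ⊤) (hproper : u 1 = 0) (a : A) :
    ∃ w : A → EReal, IsRingValuation w ∧ (∀ x, u x ≤ w x) ∧ w a = u a := by
  let F : A → ENNReal := fun x => EReal.exp (-(u x))
  have hF : ∀ x, F x ≠ ⊤ := fun x => by simp [F, EReal.neg_eq_top_iff, hbot]
  have hexp : ∀ x y, EReal.exp (-(u x + u y)) = F x * F y := fun x y => by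
    rw [EReal.neg_add (Or.inl (hbot x)) (Or.inr (hbot y)), sub_eq_add_neg, EReal.exp_add]
  have hf : SubNorm fun x => (F x).toReal := by
    refine ⟨fun x => ENNReal.toReal_nonneg, by simp [F, h0], by simp [F, hproper], fun x y => ?_,
      fun x => ?_, fun x y => ?_⟩
    · rw [← ENNReal.toReal_mul]
      apply ENNReal.toReal_mono (ENNReal.mul_ne_top (hF x) (hF y))
      rw [← hexp]
      exact EReal.exp_monotone (EReal.neg_le_neg_iff.2 (hmul x y))
    · rw [pow_two (ENNReal.toReal _), ← ENNReal.toReal_mul, ← hexp]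
      simp only [F, hsq, two_nsmul]
    · rw [← ENNReal.toReal_max (hF x) (hF y)]
      apply ENNReal.toReal_mono (by simp [hF])
      rcases min_le_iff.1 (hadd x y) with h | h
      · exact (EReal.exp_monotone (EReal.neg_le_neg_iff.2 h)).trans (le_max_left _ _)
      · exact (EReal.exp_monotone (EReal.neg_le_neg_iff.2 h)).trans (le_max_right _ _)
  obtain ⟨g, hg, hgle, hga, hgm⟩ := hf.exists_dominated a
  have hback : ∀ x, -(ENNReal.log (ENNReal.ofReal (F x).toReal)) = u x := fun x => by
    rw [ENNReal.ofReal_toReal (hF x)]; simp [F]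
  have hanti : ∀ {r s : ℝ}, r ≤ s →
      -(ENNReal.log (ENNReal.ofReal s)) ≤ -(ENNReal.log (ENNReal.ofReal r)) := fun h =>
    EReal.neg_le_neg_iff.2 (ENNReal.log_monotone (ENNReal.ofReal_le_ofReal h))
  refine ⟨fun x => -(ENNReal.log (ENNReal.ofReal (g x))),
    ⟨fun x => ?_, ?_, ?_, fun x y => ?_, fun x y => ?_⟩, fun x => ?_, ?_⟩
  · rw [Ne, EReal.neg_eq_bot_iff, ENNReal.log_eq_top_iff]; exact ENNReal.ofReal_ne_top
  · simp [hg.zero]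
  · simp [hg.one]
  · simp only [hgm]
    rw [ENNReal.ofReal_mul (hg.nonneg x), ENNReal.log_mul_add,
      EReal.neg_add (Or.inr (by rw [Ne, ENNReal.log_eq_top_iff]; exact ENNReal.ofReal_ne_top)) (Or.inl (by rw [Ne, ENNReal.log_eq_top_iff]; exact ENNReal.ofReal_ne_top)), sub_eq_add_neg]
  · rcases le_max_iff.1 (hg.add_le x y) with h | h
    · exact (min_le_left _ _).trans (hanti h)
    · exact (min_le_right _ _).trans (hanti h)
  · rw [← hback x]; exact hanti (hgle x)
  · rw [← hback a, ← hga]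

/-- Bergman's weak Nullstellensatz: for every proper sub-valuation `u` on a
commutative ring `A` and every `a ∈ A` there is a valuation `w ≥ u` with `w(a) = u(a)`;
consequently `u` is the pointwise infimum of the valuations dominating it. -/
theorem subvaluation_dominating_valuation {A : Type*} [CommRing A]
    (u : A → EReal) (hbot : ∀ x, u x ≠ ⊥)
    (hmul : ∀ x y, u x + u y ≤ u (x * y))
    (hsq : ∀ x, u (x ^ 2) = 2 • u x)
    (hadd : ∀ x y, min (u x) (u y) ≤ u (x + y))
    (h0 : u 0 = ⊤) (hproper : u 1 = 0) (a : A) :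
    (∃ w : A → EReal, IsRingValuation w ∧ (∀ x, u x ≤ w x) ∧ w a = u a) ∧
      u a = sInf { r : EReal | ∃ w : A → EReal,
        IsRingValuation w ∧ (∀ x, u x ≤ w x) ∧ r = w a } := by
  obtain ⟨w, hw, hle, hwa⟩ := exists_ringValuation u hbot hmul hsq hadd h0 hproper a
  refine ⟨⟨w, hw, hle, hwa⟩, le_antisymm (le_sInf ?_) (sInf_le ⟨w, hw, hle, hwa.symm⟩)⟩
  rintro r ⟨w', -, hle', rfl⟩
  exact hle' a
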